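/- Let A ∈ ℂ^{m×n} have singular value decomposition A = UΣV^H with singular values σ_1 ≥ σ_2 ≥ … , let 1 ≤ k ≤ min{m,n} with σ_k > 0, and partition V = [V_1, V_2] where V_1 holds the first k right singular vectors, and Σ = diag(Σ_1, Σ_2) with Σ_1 = diag(σ_1,…,σ_k). Let W ∈ ℂ^{n×ℓ} be any matrix, set W_1 = V_1^H W and W_2 = V_2^H W, and assume W_1 has full row rank, so that its Moore–Penrose pseudoinverse is W_1^† = W_1^H (W_1 W_1^H)^{−1}. Let q ≥ 0 be an integer and let P be the orthogonal projection onto the column space of Y = (AA^H)^q A W. Then, with τ_k = σ_{k+1}/σ_k, ‖(I − P)A‖_F² ≤ ‖Σ_2‖_F² + τ_k^{4q} · ‖Σ_2 W_2 W_1^†‖_F². -/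

import Mathlib

open scoped BigOperators
open Matrix

noncomputable section

/-- Squared Frobenius norm: sum of squared norms of the entries. -/
def frobSq {m n : Type*} [Fintype m] [Fintype n] {α : Type*} [Norm α] (A : Matrix m n α) : ℝ :=
  ∑ i, ∑ j, ‖A i j‖ ^ 2

/-- `P` is the orthogonal projection onto the column space of `M`: the Hermitian idempotent
matrix whose range equals the range of `M`. -/
def IsProjOnto {𝕜 : Type*} [RCLike 𝕜] {m l : ℕ}
    (P : Matrix (Fin m) (Fin m) 𝕜) (M : Matrix (Fin m) (Fin l) 𝕜) : Prop :=
  P.IsHermitian ∧ P * P = P ∧ LinearMap.range P.mulVecLin = LinearMap.range M.mulVecLin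

theorem frobSq_eq_trace {m n : Type*} [Fintype m] [Fintype n] (X : Matrix m n ℂ) :
    ((frobSq X : ℝ) : ℂ) = (Xᴴ * X).trace := by
  rw [frobSq, Finset.sum_comm]
  simp [Matrix.trace, Matrix.mul_apply, ← Complex.conj_mul']

theorem frobSq_nonneg {m n : Type*} [Fintype m] [Fintype n] (X : Matrix m n ℂ) :
    0 ≤ frobSq X :=
  Finset.sum_nonneg fun _ _ => Finset.sum_nonneg fun _ _ => by positivity

/-- The squared Frobenius norm is unitarily invariant. -/
theorem frobSq_unitary_conj {m n : Type*} [Fintype m] [Fintype n] [DecidableEq m] [DecidableEq n]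
    {U : Matrix m m ℂ} {V : Matrix n n ℂ} (hU : Uᴴ * U = 1) (hV : Vᴴ * V = 1)
    (X : Matrix m n ℂ) : frobSq (U * X * Vᴴ) = frobSq X := by
  have h : ((frobSq (U * X * Vᴴ) : ℝ) : ℂ) = ((frobSq X : ℝ) : ℂ) := by
    rw [frobSq_eq_trace, frobSq_eq_trace, Matrix.trace_mul_comm,
      show U * X * Vᴴ * (U * X * Vᴴ)ᴴ = U * (X * (Vᴴ * V) * Xᴴ * Uᴴ) by
        simp only [conjTranspose_mul, conjTranspose_conjTranspose, Matrix.mul_assoc],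
      hV, Matrix.mul_one, Matrix.trace_mul_comm,
      show X * Xᴴ * Uᴴ * U = X * Xᴴ * (Uᴴ * U) by simp only [Matrix.mul_assoc],
      hU, Matrix.mul_one, Matrix.trace_mul_comm]
  exact_mod_cast h

/-- The complement of an orthogonal projection does not increase the Frobenius norm. -/
theorem frobSq_sub_proj_mul_le {m n : Type*} [Fintype m] [Fintype n]
    {P : Matrix m m ℂ} (hP : P.IsHermitian) (hPP : P * P = P) (X : Matrix m n ℂ) :
    frobSq (X - P * X) ≤ frobSq X := by
  have h : ((frobSq X : ℝ) : ℂ) = ((frobSq (X - P * X) + frobSq (P * X) : ℝ) : ℂ) := by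
    push_cast
    rw [frobSq_eq_trace, frobSq_eq_trace, frobSq_eq_trace, ← Matrix.trace_add]
    congr 1
    have hPX : P * (P * X) = P * X := by rw [← Matrix.mul_assoc, hPP]
    simp only [conjTranspose_sub, conjTranspose_mul, hP.eq, Matrix.sub_mul, Matrix.mul_sub,
      Matrix.mul_assoc, hPX]
    abel
  have h' : frobSq X = frobSq (X - P * X) + frobSq (P * X) := by exact_mod_cast h
  linarith [frobSq_nonneg (P * X)]

/-- A projection fixes every matrix that factors through the matrix it projects onto. -/
theorem IsProjOnto.mul_mul_eq {m l : ℕ} {n : Type*} [Fintype n] [DecidableEq n]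
    {P : Matrix (Fin m) (Fin m) ℂ} {M : Matrix (Fin m) (Fin l) ℂ} (hP : IsProjOnto P M)
    (Z : Matrix (Fin l) n ℂ) : P * (M * Z) = M * Z := by
  obtain ⟨-, hPP, hr⟩ := hP
  refine Matrix.ext_of_mulVec_single fun j => ?_
  have hmem : (M * Z) *ᵥ Pi.single j 1 ∈ LinearMap.range P.mulVecLin := by
    rw [hr]
    exact ⟨Z *ᵥ Pi.single j 1, by simp only [Matrix.mulVecLin_apply, Matrix.mulVec_mulVec]⟩
  obtain ⟨v, hv⟩ := hmem
  rw [Matrix.mulVecLin_apply] at hv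
  rw [← Matrix.mulVec_mulVec, ← hv, Matrix.mulVec_mulVec, hPP]

open scoped ComplexOrder in
/-- A matrix of full row rank has invertible Gram matrix `W * Wᴴ`. -/
theorem mul_conjTranspose_mul_inv_of_rank_eq {k l : ℕ} {W : Matrix (Fin k) (Fin l) ℂ}
    (h : W.rank = k) : W * (Wᴴ * (W * Wᴴ)⁻¹) = 1 := by
  rw [← Matrix.mul_assoc]
  apply Matrix.mul_nonsing_inv
  rw [← Matrix.isUnit_iff_isUnit_det, ← Matrix.mulVec_surjective_iff_isUnit]
  have h' : (W * Wᴴ).rank = k := by rw [Matrix.rank_self_mul_conjTranspose, h]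
  have ht : LinearMap.range (W * Wᴴ).mulVecLin = ⊤ :=
    Submodule.eq_top_of_finrank_eq (by simpa [Matrix.rank] using h')
  exact LinearMap.range_eq_top.mp ht

/-- Splitting a sum over `Fin m` after its first `k` terms. -/
theorem sum_fin_split {m k : ℕ} (h : k ≤ m) (f : Fin m → ℝ) :
    ∑ i, f i = ∑ a : Fin k, f (Fin.castLE h a) +
      ∑ b : Fin (m - k), f (Fin.cast (Nat.sub_add_cancel h) (b.addNat k)) := by
  rw [← Equiv.sum_comp (finCongr (Nat.add_sub_cancel' h)) f, Fin.sum_univ_add]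
  congr 1
  refine Finset.sum_congr rfl fun b _ => congrArg f (Fin.ext ?_)
  simp [add_comm]

/-- The squared Frobenius norm of a matrix is the sum of those of its four blocks. -/
theorem frobSq_split {m n k : ℕ} (hm : k ≤ m) (hn : k ≤ n) (N : Matrix (Fin m) (Fin n) ℂ) :
    frobSq N =
      frobSq (N.submatrix (Fin.castLE hm) (Fin.castLE hn)) +
      frobSq (N.submatrix (Fin.castLE hm)
        fun b : Fin (n - k) => Fin.cast (Nat.sub_add_cancel hn) (b.addNat k)) +
      (frobSq (N.submatrix
        (fun b : Fin (m - k) => Fin.cast (Nat.sub_add_cancel hm) (b.addNat k)) (Fin.castLE hn)) +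
      frobSq (N.submatrix
        (fun b : Fin (m - k) => Fin.cast (Nat.sub_add_cancel hm) (b.addNat k))
        fun b : Fin (n - k) => Fin.cast (Nat.sub_add_cancel hn) (b.addNat k))) := by
  simp only [frobSq, Matrix.submatrix_apply, ← Finset.sum_add_distrib]
  rw [sum_fin_split hm]
  congr 1 <;> exact Finset.sum_congr rfl fun i _ => sum_fin_split hn _

/-- The rectangular `m × n` matrix with diagonal entries `s 0, s 1, …`. -/
def rectDiagonal (m n : ℕ) (s : ℕ → ℝ) : Matrix (Fin m) (Fin n) ℂ :=
  Matrix.of fun i j => if (i : ℕ) = (j : ℕ) then ((s i : ℝ) : ℂ) else 0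

theorem rectDiagonal_mul_apply {m n : ℕ} {p : Type*} (s : ℕ → ℝ) (G : Matrix (Fin n) p ℂ)
    (i : Fin m) (b : p) :
    (rectDiagonal m n s * G) i b = if h : (i : ℕ) < n then (s i : ℂ) * G ⟨i, h⟩ b else 0 := by
  rw [Matrix.mul_apply]
  split_ifs with h
  · rw [Finset.sum_eq_single ⟨i, h⟩]
    · simp [rectDiagonal]
    · intro j _ hj
      have : (i : ℕ) ≠ j := fun hij => hj (Fin.ext hij.symm)
      simp [rectDiagonal, this]
    · simp
  · refine Finset.sum_eq_zero fun j _ => ?_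
    have : (i : ℕ) ≠ j := by omega
    simp [rectDiagonal, this]

theorem rectDiagonal_mul_conjTranspose (m n : ℕ) (s : ℕ → ℝ) :
    rectDiagonal m n s * (rectDiagonal m n s)ᴴ =
      diagonal fun i : Fin m => if (i : ℕ) < n then (s i : ℂ) ^ 2 else 0 := by
  ext i j
  rw [rectDiagonal_mul_apply, Matrix.diagonal_apply]
  by_cases hij : i = j
  · subst hij
    simp [rectDiagonal, sq]
  · have : (j : ℕ) ≠ i := fun h => hij (Fin.ext h.symm)
    simp [rectDiagonal, hij, this]

theorem unitary_conj_pow {m : Type*} [Fintype m] [DecidableEq m] {U : Matrix m m ℂ}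
    (hU : Uᴴ * U = 1) (hU' : U * Uᴴ = 1) (D : Matrix m m ℂ) (q : ℕ) :
    (U * D * Uᴴ) ^ q = U * D ^ q * Uᴴ := by
  induction q with
  | zero => simp [hU']
  | succ q ih =>
    rw [pow_succ, ih, pow_succ,
      show U * D ^ q * Uᴴ * (U * D * Uᴴ) = U * D ^ q * (Uᴴ * U) * D * Uᴴ by
        simp only [Matrix.mul_assoc], hU]
    simp only [Matrix.mul_one, Matrix.mul_assoc]

/-- **Deterministic structural bound for randomized subspace iteration** (Theorem A.1).
Given the SVD `A = U Σ Vᴴ` with decreasing singular values `σ_1 ≥ σ_2 ≥ …` (`σ` is 1-indexed),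
an arbitrary sampling matrix `W ∈ ℂ^{n×ℓ}`, `W₁ = V₁ᴴ W` (top `k` right singular vectors),
`W₂ = V₂ᴴ W` with `W₁` of full row rank and pseudoinverse `W₁† = W₁ᴴ (W₁ W₁ᴴ)⁻¹`, and `P` the
orthogonal projection onto the column space of `Y = (AAᴴ)^q A W`, one has
`‖(I - P)A‖_F² ≤ ‖S₂‖_F² + τ_k^{4q} ‖S₂ W₂ W₁†‖_F²` where `τ_k = σ_{k+1}/σ_k`. -/
theorem structural_bound_subspace_iteration
    {m n k l : ℕ} (q : ℕ) (hk1 : 1 ≤ k) (hk : k ≤ min m n)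
    (A : Matrix (Fin m) (Fin n) ℂ)
    (U : Matrix (Fin m) (Fin m) ℂ) (V : Matrix (Fin n) (Fin n) ℂ)
    (hU : U ∈ Matrix.unitaryGroup (Fin m) ℂ) (hV : V ∈ Matrix.unitaryGroup (Fin n) ℂ)
    (σ : ℕ → ℝ)
    (hσ_dec : ∀ i j, 1 ≤ i → i ≤ j → j ≤ min m n → σ j ≤ σ i)
    (hσ_nonneg : ∀ j, j ≤ min m n → 0 ≤ σ j)
    (hσk : 0 < σ k)
    (hA : A = U *
      (Matrix.of fun (i : Fin m) (j : Fin n) =>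
        if (i : ℕ) = (j : ℕ) then ((σ ((i : ℕ) + 1) : ℝ) : ℂ) else 0) * Vᴴ)
    (W : Matrix (Fin n) (Fin l) ℂ)
    (V₁ : Matrix (Fin n) (Fin k) ℂ)
    (hV₁ : V₁ = V.submatrix id (Fin.castLE (hk.trans (min_le_right m n))))
    (V₂ : Matrix (Fin n) (Fin (n - k)) ℂ)
    (hV₂ : V₂ = V.submatrix id
      (fun j : Fin (n - k) =>
        Fin.cast (Nat.sub_add_cancel (hk.trans (min_le_right m n))) (j.addNat k)))
    (W₁ : Matrix (Fin k) (Fin l) ℂ) (hW₁ : W₁ = V₁ᴴ * W)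
    (W₂ : Matrix (Fin (n - k)) (Fin l) ℂ) (hW₂ : W₂ = V₂ᴴ * W)
    (hW₁rank : W₁.rank = k)
    (W₁pinv : Matrix (Fin l) (Fin k) ℂ) (hW₁pinv : W₁pinv = W₁ᴴ * (W₁ * W₁ᴴ)⁻¹)
    (S₂ : Matrix (Fin (m - k)) (Fin (n - k)) ℂ)
    (hS₂ : S₂ = Matrix.of fun (i : Fin (m - k)) (j : Fin (n - k)) =>
      if (i : ℕ) = (j : ℕ) then ((σ (k + (i : ℕ) + 1) : ℝ) : ℂ) else 0)
    (P : Matrix (Fin m) (Fin m) ℂ)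
    (hP : IsProjOnto P ((A * Aᴴ) ^ q * A * W)) :
    frobSq (A - P * A) ≤
      frobSq S₂ + (σ (k + 1) / σ k) ^ (4 * q) * frobSq (S₂ * W₂ * W₁pinv) := by
  have hm : k ≤ m := hk.trans (min_le_left m n)
  have hn : k ≤ n := hk.trans (min_le_right m n)
  have hUU : Uᴴ * U = 1 := Matrix.mem_unitaryGroup_iff'.mp hU
  have hUU' : U * Uᴴ = 1 := Matrix.mem_unitaryGroup_iff.mp hU
  have hVV : Vᴴ * V = 1 := Matrix.mem_unitaryGroup_iff'.mp hV
  have hVV' : V * Vᴴ = 1 := Matrix.mem_unitaryGroup_iff.mp hV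
  set S : Matrix (Fin m) (Fin n) ℂ := rectDiagonal m n fun i => σ (i + 1) with hS
  replace hA : A = U * S * Vᴴ := hA
  replace hS₂ : S₂ = rectDiagonal (m - k) (n - k) fun i => σ (k + i + 1) := hS₂
  set d : Fin m → ℂ := fun i => if (i : ℕ) < n then (σ (i + 1) : ℂ) ^ 2 else 0 with hd
  have hAA : (A * Aᴴ) ^ q = U * diagonal (d ^ q) * Uᴴ := by
    rw [← Matrix.diagonal_pow, ← unitary_conj_pow hUU hUU', hd,
      ← rectDiagonal_mul_conjTranspose m n fun i => σ (i + 1), ← hS, hA]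
    rw [show U * S * Vᴴ * (U * S * Vᴴ)ᴴ = U * S * (Vᴴ * V) * Sᴴ * Uᴴ by
      simp only [conjTranspose_mul, conjTranspose_conjTranspose, Matrix.mul_assoc], hVV]
    simp only [Matrix.mul_one, Matrix.mul_assoc]
  set G : Matrix (Fin n) (Fin k) ℂ := Vᴴ * W * W₁pinv with hG
  set E : Matrix (Fin k) (Fin n) ℂ := V₁ᴴ * V with hE
  set D : Matrix (Fin k) (Fin k) ℂ :=
    diagonal fun a => ((σ ((a : ℕ) + 1) : ℂ) ^ (2 * q))⁻¹ with hD
  set Z : Matrix (Fin l) (Fin n) ℂ := W₁pinv * D * V₁ᴴ with hZ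
  set N : Matrix (Fin m) (Fin n) ℂ := S - diagonal (d ^ q) * (S * G) * D * E with hN
  -- Subtracting a matrix with range inside that of the sample leaves `N` in singular coordinates.
  have hres : A - (A * Aᴴ) ^ q * A * W * Z = U * N * Vᴴ := by
    rw [hAA, hN, Matrix.mul_sub, Matrix.sub_mul, hZ, hE, hG, hA]
    congr 1
    rw [show U * diagonal (d ^ q) * Uᴴ * (U * S * Vᴴ) * W * (W₁pinv * D * V₁ᴴ) =
        U * diagonal (d ^ q) * (Uᴴ * U) * S * Vᴴ * W * W₁pinv * D * V₁ᴴ by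
      simp only [Matrix.mul_assoc], hUU,
      show U * (diagonal (d ^ q) * (S * (Vᴴ * W * W₁pinv)) * D * (V₁ᴴ * V)) * Vᴴ =
        U * diagonal (d ^ q) * S * Vᴴ * W * W₁pinv * D * V₁ᴴ * (V * Vᴴ) by
      simp only [Matrix.mul_assoc], hVV']
    simp only [Matrix.mul_one, Matrix.mul_assoc]
  have hle : frobSq (A - P * A) ≤ frobSq N := by
    rw [← frobSq_unitary_conj hUU hVV N, ← hres]
    refine le_of_eq_of_le (congrArg frobSq ?_) (frobSq_sub_proj_mul_le hP.1 hP.2.1 _)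
    rw [Matrix.mul_sub, hP.mul_mul_eq]
    abel
  have hG₁ : ∀ a b, G (Fin.castLE hn a) b = if a = b then 1 else 0 := by
    intro a b
    have h : (W₁ * W₁pinv) a b = if a = b then 1 else 0 := by
      rw [hW₁pinv, mul_conjTranspose_mul_inv_of_rank_eq hW₁rank, Matrix.one_apply]
    rw [← h, hW₁, hV₁]
    rfl
  have hG₂ : ∀ c b, G (Fin.cast (Nat.sub_add_cancel hn) (c.addNat k)) b = (W₂ * W₁pinv) c b := by
    intro c b
    rw [hW₂, hV₂]
    rfl
  have hEapp : ∀ a j, E a j = if Fin.castLE hn a = j then 1 else 0 := by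
    intro a j
    rw [← Matrix.one_apply, ← hVV, hE, hV₁]
    rfl
  have hN₁ : ∀ i b, N i (Fin.castLE hn b) = S i (Fin.castLE hn b) -
      d i ^ q * (S * G) i b * ((σ ((b : ℕ) + 1) : ℂ) ^ (2 * q))⁻¹ := by
    intro i b
    rw [hN, Matrix.sub_apply, Matrix.mul_apply]
    congr 1
    rw [Finset.sum_eq_single b]
    · rw [hEapp, if_pos rfl, hD, Matrix.mul_diagonal, Matrix.diagonal_mul]
      simp
    · intro c _ hc
      rw [hEapp, if_neg fun h => hc (Fin.castLE_injective hn h), mul_zero]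
    · simp
  have hN₂ : ∀ i (c : Fin (n - k)), N i (Fin.cast (Nat.sub_add_cancel hn) (c.addNat k)) =
      S i (Fin.cast (Nat.sub_add_cancel hn) (c.addNat k)) := by
    intro i c
    rw [hN, Matrix.sub_apply, Matrix.mul_apply, Finset.sum_eq_zero, sub_zero]
    intro a _
    have hne : Fin.castLE hn a ≠ Fin.cast (Nat.sub_add_cancel hn) (c.addNat k) := by
      intro h
      have := congrArg Fin.val h
      simp at this
      omega
    rw [hEapp, if_neg hne, mul_zero]
  have hσpos : ∀ a : Fin k, σ k ≤ σ ((a : ℕ) + 1) := fun a =>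
    hσ_dec _ _ (by omega) (by omega) hk
  have hblock₁₁ : frobSq (N.submatrix (Fin.castLE hm) (Fin.castLE hn)) = 0 := by
    refine Finset.sum_eq_zero fun a _ => Finset.sum_eq_zero fun b _ => ?_
    have han : (a : ℕ) < n := by omega
    have hσa : (σ ((a : ℕ) + 1) : ℂ) ≠ 0 := by
      exact_mod_cast (hσk.trans_le (hσpos a)).ne'
    have hGa : G ⟨a, han⟩ b = if a = b then 1 else 0 := hG₁ a b
    rw [Matrix.submatrix_apply, hN₁, hS, rectDiagonal_mul_apply]
    simp only [Fin.val_castLE, han, dite_true, hGa, hd, if_true]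
    by_cases hab : a = b
    · subst hab
      simp [rectDiagonal, ← pow_mul]
      field_simp
      simp
    · have : (a : ℕ) ≠ b := fun h => hab (Fin.ext h)
      simp [rectDiagonal, hab, this]
  have hblock₁₂ : frobSq (N.submatrix (Fin.castLE hm)
      fun b : Fin (n - k) => Fin.cast (Nat.sub_add_cancel hn) (b.addNat k)) = 0 := by
    refine Finset.sum_eq_zero fun a _ => Finset.sum_eq_zero fun c _ => ?_
    rw [Matrix.submatrix_apply, hN₂]
    have : (a : ℕ) ≠ c + k := by omega
    simp [hS, rectDiagonal, this]
  have hblock₂₂ : frobSq (N.submatrix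
      (fun b : Fin (m - k) => Fin.cast (Nat.sub_add_cancel hm) (b.addNat k))
      fun b : Fin (n - k) => Fin.cast (Nat.sub_add_cancel hn) (b.addNat k)) = frobSq S₂ := by
    refine Finset.sum_congr rfl fun i _ => Finset.sum_congr rfl fun c _ => ?_
    rw [Matrix.submatrix_apply, hN₂]
    simp [hS, hS₂, rectDiagonal, add_comm]
  have hblock₂₁ : frobSq (N.submatrix
      (fun b : Fin (m - k) => Fin.cast (Nat.sub_add_cancel hm) (b.addNat k)) (Fin.castLE hn)) ≤
      (σ (k + 1) / σ k) ^ (4 * q) * frobSq (S₂ * W₂ * W₁pinv) := by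
    rw [frobSq, frobSq, Finset.mul_sum]
    refine Finset.sum_le_sum fun i _ => ?_
    rw [Finset.mul_sum]
    refine Finset.sum_le_sum fun b _ => ?_
    rw [Matrix.submatrix_apply, hN₁, Matrix.mul_assoc, hS, hS₂, rectDiagonal_mul_apply,
      rectDiagonal_mul_apply]
    have hSz : rectDiagonal m n (fun i => σ (i + 1))
        (Fin.cast (Nat.sub_add_cancel hm) (i.addNat k)) (Fin.castLE hn b) = 0 := by
      have : (i : ℕ) + k ≠ b := by omega
      simp [rectDiagonal, this]
    rw [hSz, zero_sub, norm_neg]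
    by_cases hin : (i : ℕ) < n - k
    · have hin' : (i : ℕ) + k < n := by omega
      have hGi : G ⟨(i : ℕ) + k, hin'⟩ b = (W₂ * W₁pinv) ⟨i, hin⟩ b := hG₂ ⟨i, hin⟩ b
      have hmin : k + i + 1 ≤ min m n := by omega
      have h0 : 0 ≤ σ (k + i + 1) := hσ_nonneg _ hmin
      have h1 : σ (k + i + 1) ≤ σ (k + 1) := hσ_dec _ _ (by omega) (by omega) hmin
      have hb := hσpos b
      have hb0 : 0 < σ ((b : ℕ) + 1) := hσk.trans_le hb
      have hratio : σ (k + i + 1) / σ ((b : ℕ) + 1) ≤ σ (k + 1) / σ k :=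
        div_le_div₀ (h0.trans h1) h1 hσk hb
      simp only [hd, Fin.val_cast, Fin.val_addNat, hin, hin', dite_true, if_true, hGi]
      rw [add_comm (i : ℕ) k]
      set x := ((σ (k + i + 1) : ℝ) : ℂ) * (W₂ * W₁pinv) ⟨i, hin⟩ b
      have heq :
          ‖(((σ (k + i + 1) : ℝ) : ℂ) ^ 2) ^ q * x * ((σ ((b : ℕ) + 1) : ℂ) ^ (2 * q))⁻¹‖ ^ 2
          = (σ (k + i + 1) / σ ((b : ℕ) + 1)) ^ (4 * q) * ‖x‖ ^ 2 := by
        rw [norm_mul, norm_mul, norm_inv, norm_pow, norm_pow, norm_pow, Complex.norm_of_nonneg h0,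
          Complex.norm_of_nonneg hb0.le, div_pow, div_eq_mul_inv,
          show 4 * q = 2 * q * 2 by ring, pow_mul _ (2 * q) 2, pow_mul _ (2 * q) 2, ← pow_mul]
        ring
      rw [heq]
      gcongr
    · have hin' : ¬ (i : ℕ) + k < n := by omega
      simp [hin, hin']
  rw [frobSq_split hm hn N, hblock₁₁, hblock₁₂, hblock₂₂] at hle
  linarith

end
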